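/- Let q1, q2, q3 be natural numbers, and let H be the simple graph whose vertices are the symbols a_i for 1 ≤ i ≤ max(q1, q2), b_j for 1 ≤ j ≤ max(q1, q3), and c_l for 1 ≤ l ≤ max(q2, q3), in which two vertices with the same letter are never adjacent, and a_i b_j are adjacent iff i + j ≤ q1 + 1, a_i c_l adjacent iff i + l ≤ q2 + 1, and b_j c_l adjacent iff j + l ≤ q3 + 1. Then the complement graph H̄ (two distinct vertices adjacent in H̄ iff not adjacent in H) has no induced r-cycle for any r ≥ 4. -/

import Mathlib

/-- The three letters labeling vertices in the three-variable case. -/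
inductive Letter3 : Type
  | a | b | c
deriving DecidableEq

/-- Whether a labeled vertex is in range for `(q1, q2, q3)`. -/
def inRange3 (q1 q2 q3 : ℕ) : Letter3 × ℕ → Prop
  | (Letter3.a, i) => 1 ≤ i ∧ i ≤ max q1 q2
  | (Letter3.b, j) => 1 ≤ j ∧ j ≤ max q1 q3
  | (Letter3.c, l) => 1 ≤ l ∧ l ≤ max q2 q3

/-- The vertex set of the graph `H`. -/
def Vertex3 (q1 q2 q3 : ℕ) : Type :=
  {v : Letter3 × ℕ // inRange3 q1 q2 q3 v}

/-- Directed adjacency (one orientation of each cross-letter edge rule). -/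
def dirAdj3 (q1 q2 q3 : ℕ) : Letter3 × ℕ → Letter3 × ℕ → Prop
  | (Letter3.a, i), (Letter3.b, j) => i + j ≤ q1 + 1
  | (Letter3.a, i), (Letter3.c, l) => i + l ≤ q2 + 1
  | (Letter3.b, j), (Letter3.c, l) => j + l ≤ q3 + 1
  | _, _ => False

/-- The graph `H` whose edge ideal is the Alexander dual of the polarization of
`(a,b)^{q1} ∩ (a,c)^{q2} ∩ (b,c)^{q3}`. -/
def triGraph (q1 q2 q3 : ℕ) : SimpleGraph (Vertex3 q1 q2 q3) where
  Adj u v := dirAdj3 q1 q2 q3 u.val v.val ∨ dirAdj3 q1 q2 q3 v.val u.val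
  symm := ⟨fun u v h => h.symm⟩
  loopless := by
    constructor
    rintro ⟨⟨L, i⟩, _⟩ h
    cases L <;> simp [dirAdj3] at h

/-- An induced `r`-cycle in a graph: `r` distinct vertices, adjacent exactly when
cyclically consecutive. -/
def IsInducedCycle {V : Type*} (H : SimpleGraph V) (r : ℕ) (v : Fin r → V) : Prop :=
  Function.Injective v ∧
    ∀ s t : Fin r, H.Adj (v s) (v t) ↔ ((s.val + 1) % r = t.val ∨ (t.val + 1) % r = s.val)

instance : Fintype Letter3 :=
  ⟨{Letter3.a, Letter3.b, Letter3.c}, fun x => by cases x <;> decide⟩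

/-- Neighborhoods of vertices with the same letter are nested: they shrink as the index grows. -/
theorem triGraph_adj_of_index_le {q1 q2 q3 : ℕ} {x y w : Vertex3 q1 q2 q3}
    (hletter : x.val.1 = y.val.1) (hle : x.val.2 ≤ y.val.2)
    (h : (triGraph q1 q2 q3).Adj y w) : (triGraph q1 q2 q3).Adj x w := by
  obtain ⟨⟨X, i⟩, _⟩ := x
  obtain ⟨⟨Y, j⟩, _⟩ := y
  obtain ⟨⟨W, k⟩, _⟩ := w
  cases X <;> cases Y <;> cases W <;> simp_all [triGraph, dirAdj3] <;> omega

/-- Distinct vertices with the same letter are not adjacent. -/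
theorem triGraph_not_adj_of_letter_eq {q1 q2 q3 : ℕ} {x y : Vertex3 q1 q2 q3}
    (hletter : x.val.1 = y.val.1) : ¬ (triGraph q1 q2 q3).Adj x y := by
  obtain ⟨⟨X, i⟩, _⟩ := x
  obtain ⟨⟨Y, j⟩, _⟩ := y
  cases X <;> cases Y <;> simp_all [triGraph, dirAdj3]

theorem add_one_mod_eq_ite {x r : ℕ} (h : x < r) :
    (x + 1) % r = if x + 1 = r then 0 else x + 1 := by
  split_ifs with hx
  · simp [hx]
  · exact Nat.mod_eq_of_lt (by omega)

/-- Consecutive vertices of an induced cycle of length at least four in the complement of `G`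
have incomparable neighborhoods in `G`. -/
theorem IsInducedCycle.exists_adj_compl_of_succ {V : Type*} {G : SimpleGraph V} {r : ℕ}
    (hr : 4 ≤ r) {v : Fin r → V} (hv : IsInducedCycle Gᶜ r v) {s t : Fin r}
    (hst : (s.val + 1) % r = t.val) :
    (∃ w, G.Adj (v s) w ∧ ¬ G.Adj (v t) w) ∧ (∃ w, G.Adj (v t) w ∧ ¬ G.Adj (v s) w) := by
  obtain ⟨hinj, hadj⟩ := hv
  have adj_of {x y : Fin r} (hne : x ≠ y) (hxy : (x.val + 1) % r ≠ y.val)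
      (hyx : (y.val + 1) % r ≠ x.val) : G.Adj (v x) (v y) := by
    by_contra h
    have := (hadj x y).1 ((G.compl_adj _ _).2 ⟨hinj.ne hne, h⟩)
    tauto
  have not_adj_of {x y : Fin r}
      (hxy : (x.val + 1) % r = y.val ∨ (y.val + 1) % r = x.val) : ¬ G.Adj (v x) (v y) :=
    ((G.compl_adj _ _).1 ((hadj x y).2 hxy)).2
  obtain ⟨s, hs⟩ := s
  obtain ⟨t, ht⟩ := t
  obtain ⟨p, hp, hps⟩ : ∃ p < r, (p + 1) % r = s := by
    rcases s with _ | s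
    · exact ⟨r - 1, by omega, by rw [add_one_mod_eq_ite (by omega)]; split_ifs <;> omega⟩
    · exact ⟨s, by omega, Nat.mod_eq_of_lt hs⟩
  obtain ⟨n, hn, htn⟩ : ∃ n < r, (t + 1) % r = n := ⟨_, Nat.mod_lt _ (by omega), rfl⟩
  refine ⟨⟨v ⟨n, hn⟩, adj_of ?_ ?_ ?_, not_adj_of (.inl htn)⟩,
    ⟨v ⟨p, hp⟩, adj_of ?_ ?_ ?_, not_adj_of (.inr hps)⟩⟩ <;>
  · simp only [ne_eq, Fin.mk.injEq, add_one_mod_eq_ite, hs, ht, hp, hn] at *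
    split_ifs at * <;> omega

/-- Consecutive vertices of an induced cycle of length at least four in the complement of
`triGraph` have different letters. -/
theorem IsInducedCycle.letter_ne_of_succ {q1 q2 q3 r : ℕ} (hr : 4 ≤ r)
    {v : Fin r → Vertex3 q1 q2 q3} (hv : IsInducedCycle (triGraph q1 q2 q3)ᶜ r v) {s t : Fin r}
    (hst : (s.val + 1) % r = t.val) : (v s).val.1 ≠ (v t).val.1 := by
  intro hletter
  obtain ⟨⟨w, hsw, htw⟩, ⟨u, htu, hsu⟩⟩ := hv.exists_adj_compl_of_succ hr hst
  rcases le_total (v s).val.2 (v t).val.2 with hle | hle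
  · exact hsu (triGraph_adj_of_index_le hletter hle htu)
  · exact htw (triGraph_adj_of_index_le hletter.symm hle hsw)

/-- Remark 3.4: in the three-variable case the complement graph `H̄` has no induced
`r`-cycle for any `r ≥ 4` (i.e. `H̄` is chordal). -/
theorem three_letter_complement_chordal (q1 q2 q3 : ℕ) (r : ℕ) (hr : 4 ≤ r) :
    ¬ ∃ v : Fin r → Vertex3 q1 q2 q3, IsInducedCycle (triGraph q1 q2 q3)ᶜ r v := by
  rintro ⟨v, hv⟩
  have hcard : Fintype.card Letter3 < Fintype.card (Fin r) := by
    rw [Fintype.card_fin]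
    exact lt_of_lt_of_le (by decide) hr
  obtain ⟨s, t, hne, hletter⟩ :=
    Fintype.exists_ne_map_eq_of_card_lt (fun s => (v s).val.1) hcard
  rcases (hv.2 s t).1 (((triGraph q1 q2 q3).compl_adj _ _).2
    ⟨hv.1.ne hne, triGraph_not_adj_of_letter_eq hletter⟩) with h | h
  · exact hv.letter_ne_of_succ hr h hletter
  · exact hv.letter_ne_of_succ hr h hletter.symm
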